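/- Let I ⊆ ℝ be an interval and T > 0. For each α ∈ I let f^α : ℝ → ℝ be a bounded Lipschitz function, and let S^α : [0,T] × L¹(ℝ) → L¹(ℝ), (t,u) ↦ S_t^α u, be a family of maps such that: (i) for every u ∈ L¹(ℝ) the map t ↦ S_t^α u is continuous from [0,T] to L¹(ℝ); (ii) ‖S_t^α u − S_t^α v‖_{L¹} ≤ ‖u − v‖_{L¹} for all u, v ∈ L¹(ℝ) and t ∈ [0,T]; (iii) for every w ∈ BV(ℝ) ∩ L¹(ℝ), every t ∈ [0,T] and all α, β ∈ I one has ‖S_t^α w − S_t^β w‖_{L¹} ≤ t · ‖f^α − f^β‖_{C^{0,1}} · TV(w). If moreover the map α ↦ f^α is continuous from I into the space of bounded Lipschitz functions equipped with the norm ‖·‖_{C^{0,1}}, then the map (t, u, α) ↦ (S_t^α u, α) is continuous from [0,T] × L¹(ℝ) × I (with the norm |s| + ‖u‖_{L¹} + |α|) to L¹(ℝ) × I (with the norm ‖u‖_{L¹} + |α|). -/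

import Mathlib

open MeasureTheory Set
open scoped NNReal

/-- The `C^{0,1}`-norm of a function `g : ℝ → ℝ`: sup-norm plus optimal Lipschitz constant. -/
noncomputable def holNorm (g : ℝ → ℝ) : ℝ :=
  (⨆ x : ℝ, |g x|) +
    ⨆ p : {p : ℝ × ℝ // p.1 ≠ p.2}, |g p.1.1 - g p.1.2| / |p.1.1 - p.1.2|

/-- The total variation of a function `u : ℝ → ℝ` (as a real number). -/
noncomputable def tv (u : ℝ → ℝ) : ℝ := (eVariationOn u Set.univ).toReal

/-- A Lipschitz function with compact support on the real line has bounded variation. -/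
theorem LipschitzWith.boundedVariationOn_univ_of_hasCompactSupport {w : ℝ → ℝ} {K : ℝ≥0}
    (hw : LipschitzWith K w) (hc : HasCompactSupport w) : BoundedVariationOn w Set.univ := by
  obtain ⟨R, hR⟩ := hc.isCompact.isBounded.subset_ball_lt 0 0
  have hzero : ∀ x : ℝ, R ≤ |x| → w x = 0 := fun x hx => by
    by_contra h
    have hx' := hR.2 (subset_tsupport w h)
    rw [mem_ball_zero_iff, Real.norm_eq_abs] at hx'
    linarith
  have hR0 : -R ≤ R := by linarith [hR.1]
  have hclamp : w ∘ (fun x => max (-R) (min R x)) = w := by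
    funext x
    simp only [Function.comp_apply]
    rcases le_or_gt R x with h | h
    · rw [min_eq_left h, max_eq_right hR0, hzero R (le_abs_self R),
        hzero x (h.trans (le_abs_self x))]
    · rw [min_eq_right h.le]
      rcases le_or_gt x (-R) with h' | h'
      · rw [max_eq_left h', hzero x (by linarith [neg_le_abs x]),
          hzero (-R) (by linarith [neg_le_abs (-R)])]
      · rw [max_eq_right h'.le]
  have hle : eVariationOn (w ∘ fun x => max (-R) (min R x)) Set.univ
      ≤ eVariationOn w (Icc (-R) R) :=
    eVariationOn.comp_le_of_monotoneOn w _
      (fun x _ y _ hxy => max_le_max le_rfl (min_le_min le_rfl hxy))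
      (fun x _ => ⟨le_max_left _ _, max_le hR0 (min_le_left _ _)⟩)
  rw [hclamp] at hle
  have hfin := hw.locallyBoundedVariationOn Set.univ (-R) R (mem_univ _) (mem_univ _)
  rw [univ_inter] at hfin
  exact ne_top_of_le_ne_top hfin hle

/-- Integrable functions of bounded variation are dense in `L¹(ℝ)`. -/
theorem exists_boundedVariationOn_norm_sub_toLp_le (u : Lp ℝ 1 (volume : Measure ℝ)) {ε : ℝ}
    (hε : 0 < ε) :
    ∃ (w : ℝ → ℝ) (hw : MemLp w 1 (volume : Measure ℝ)),
      BoundedVariationOn w Set.univ ∧ ‖u - hw.toLp w‖ ≤ ε := by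
  obtain ⟨w, hc, hs, hle⟩ := (Lp.memLp u).exist_eLpNorm_sub_le ENNReal.one_ne_top le_rfl hε
  obtain ⟨K, hK⟩ := ContDiff.lipschitzWith_of_hasCompactSupport hc hs (by simp)
  have hw : MemLp w 1 (volume : Measure ℝ) := hs.continuous.memLp_of_hasCompactSupport hc
  refine ⟨w, hw, hK.boundedVariationOn_univ_of_hasCompactSupport hc, ?_⟩
  rw [Lp.norm_def]
  refine ENNReal.toReal_le_of_le_ofReal hε.le (le_of_eq_of_le (eLpNorm_congr_ae ?_) hle)
  filter_upwards [Lp.coeFn_sub u (hw.toLp w), hw.coeFn_toLp] with x h₁ h₂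
  rw [h₁, Pi.sub_apply, Pi.sub_apply, h₂]

/-- Lemma 2.1: if the family of bounded Lipschitz flux functions `α ↦ f^α` is continuous
in the `C^{0,1}`-norm, then `(t,u,α) ↦ (S_t^α u, α)` is continuous on `[0,T] × L¹(ℝ) × I`. -/
theorem flow_map_continuous
    (I : Set ℝ) (hI : I.OrdConnected) (T : ℝ) (hT : 0 < T)
    (f : ℝ → ℝ → ℝ)
    (hf_bdd : ∀ α ∈ I, ∃ C : ℝ, ∀ x, |f α x| ≤ C)
    (hf_lip : ∀ α ∈ I, ∃ K : ℝ≥0, LipschitzWith K (f α))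
    (S : ℝ → ℝ → Lp ℝ 1 (volume : Measure ℝ) → Lp ℝ 1 (volume : Measure ℝ))
    (hS_cont : ∀ α ∈ I, ∀ u, ContinuousOn (fun t => S α t u) (Icc 0 T))
    (hS_contr : ∀ α ∈ I, ∀ t ∈ Icc (0:ℝ) T, ∀ u v,
      ‖S α t u - S α t v‖ ≤ ‖u - v‖)
    (hS_flux : ∀ w : ℝ → ℝ, ∀ hw : MemLp w 1 (volume : Measure ℝ),
      BoundedVariationOn w Set.univ →
      ∀ t ∈ Icc (0:ℝ) T, ∀ α ∈ I, ∀ β ∈ I,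
        ‖S α t (hw.toLp w) - S β t (hw.toLp w)‖ ≤
          t * holNorm (fun x => f α x - f β x) * tv w)
    (hf_cont : ∀ β ∈ I, ∀ ε > (0:ℝ), ∃ δ > (0:ℝ), ∀ α ∈ I,
      |α - β| < δ → holNorm (fun x => f α x - f β x) < ε) :
    ContinuousOn
      (fun p : ℝ × Lp ℝ 1 (volume : Measure ℝ) × ℝ => (S p.2.2 p.1 p.2.1, p.2.2))
      (Icc 0 T ×ˢ (univ ×ˢ I)) := by
  refine ContinuousOn.prodMk ?_ (by fun_prop)
  rintro ⟨t₀, u₀, α₀⟩ ⟨ht₀, -, hα₀⟩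
  simp only at ht₀ hα₀
  rw [Metric.continuousWithinAt_iff]
  intro ε hε
  obtain ⟨w, hw, hwBV, huw⟩ :=
    exists_boundedVariationOn_norm_sub_toLp_le u₀ (ε := ε / 8) (by positivity)
  have htv : 0 ≤ tv w := ENNReal.toReal_nonneg
  have hden : 0 < T * tv w + 1 := by positivity
  set η : ℝ := ε / 8 / (T * tv w + 1) with hη_def
  have hη : 0 < η := by positivity
  have hηε : η * (T * tv w + 1) = ε / 8 := div_mul_cancel₀ _ hden.ne'
  obtain ⟨δ₁, hδ₁, h₁⟩ := hf_cont α₀ hα₀ η hη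
  obtain ⟨δ₂, hδ₂, h₂⟩ :=
    Metric.continuousWithinAt_iff.1 (hS_cont α₀ hα₀ u₀ t₀ ht₀) (ε / 8) (by positivity)
  refine ⟨min (min δ₁ δ₂) (ε / 8), by positivity, ?_⟩
  rintro ⟨t, u, α⟩ ⟨ht, -, hα⟩ hd
  simp only at ht hα
  simp only [Prod.dist_eq, max_lt_iff, lt_min_iff] at hd
  obtain ⟨⟨⟨-, -, hαd⟩, htd, -⟩, -, hud, -⟩ := hd
  have htime := h₂ ht htd
  rw [dist_eq_norm] at htime hud ⊢
  have hflux : ‖S α t (hw.toLp w) - S α₀ t (hw.toLp w)‖ ≤ ε / 8 := by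
    refine (hS_flux w hw hwBV t ht α hα α₀ hα₀).trans ?_
    have hhol := (h₁ α hα hαd).le
    calc t * holNorm (fun x => f α x - f α₀ x) * tv w ≤ t * η * tv w := by
          have := ht.1
          gcongr
      _ ≤ T * η * tv w := by
          have := ht.2
          gcongr
      _ ≤ ε / 8 := by linarith
  have hu := hS_contr α hα t ht u (hw.toLp w)
  have hu₀ := hS_contr α₀ hα₀ t ht (hw.toLp w) u₀
  rw [norm_sub_rev (hw.toLp w) u₀] at hu₀
  have htri := norm_sub_le_norm_sub_add_norm_sub u u₀ (hw.toLp w)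
  have htri₁ := norm_sub_le_norm_sub_add_norm_sub (S α t u) (S α t (hw.toLp w)) (S α₀ t₀ u₀)
  have htri₂ := norm_sub_le_norm_sub_add_norm_sub
    (S α t (hw.toLp w)) (S α₀ t (hw.toLp w)) (S α₀ t₀ u₀)
  have htri₃ := norm_sub_le_norm_sub_add_norm_sub
    (S α₀ t (hw.toLp w)) (S α₀ t u₀) (S α₀ t₀ u₀)
  simp only
  linarith
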